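/- There exists a constant C > 0 such that every simple graph G on n ≥ 2 vertices that admits a planar straight-line drawing with all vertex points in convex position (i.e., every outer-planar graph) admits a planar straight-line drawing in which every vertex has an integer y-coordinate in {1, …, ⌈C·log₂ n⌉}. -/

import Mathlib

open Set

noncomputable section

/-- Points of the plane. -/
abbrev Pt : Type := ℝ × ℝ

/-- The image (set of points) of a polygonal chain given by its list of breakpoints. -/
def chainSet : List Pt → Set Pt
  | [] => ∅
  | [p] => {p}
  | p :: q :: rest => segment ℝ p q ∪ chainSet (q :: rest)

/-- The bends (interior junction points) of a polygonal chain. -/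
def chainBends (l : List Pt) : List Pt := (l.drop 1).dropLast

/-- `S` is the image of a simple (injective) curve from `a` to `b`. -/
def IsSimpleArc (S : Set Pt) (a b : Pt) : Prop :=
  ∃ γ : ℝ → Pt, ContinuousOn γ (Icc (0:ℝ) 1) ∧ InjOn γ (Icc (0:ℝ) 1) ∧
    γ '' Icc (0:ℝ) 1 = S ∧ γ 0 = a ∧ γ 1 = b

/-- A poly-line drawing of a simple graph `G`: an injective placement of the vertices
together with, for each edge, a simple polygonal arc joining the endpoints. -/
structure PolyDrawing {V : Type} (G : SimpleGraph V) where
  pos : V → Pt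
  pos_inj : Function.Injective pos
  arc : Sym2 V → List Pt
  arc_ends : ∀ u v : V, G.Adj u v →
    ((arc s(u, v)).head? = some (pos u) ∧ (arc s(u, v)).getLast? = some (pos v)) ∨
    ((arc s(u, v)).head? = some (pos v) ∧ (arc s(u, v)).getLast? = some (pos u))
  arc_simple : ∀ u v : V, G.Adj u v →
    IsSimpleArc (chainSet (arc s(u, v))) (pos u) (pos v)

namespace PolyDrawing

variable {V : Type} {G : SimpleGraph V}

/-- The set of points used by the arc of an edge. -/
def edgePts (Γ : PolyDrawing G) (e : Sym2 V) : Set Pt := chainSet (Γ.arc e)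

/-- Planarity: no vertex point lies on the arc of a non-incident edge, and arcs of
distinct edges meet only in images of common endpoints. -/
def IsPlanar (Γ : PolyDrawing G) : Prop :=
  (∀ v : V, ∀ e ∈ G.edgeSet, v ∉ e → Γ.pos v ∉ Γ.edgePts e) ∧
  (∀ e ∈ G.edgeSet, ∀ f ∈ G.edgeSet, e ≠ f →
    ∀ p ∈ Γ.edgePts e ∩ Γ.edgePts f, ∃ w : V, w ∈ e ∧ w ∈ f ∧ p = Γ.pos w)

/-- `y`-monotone: along every edge arc the `y`-coordinate varies weakly monotonically. -/
def IsYMonotone (Γ : PolyDrawing G) : Prop :=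
  ∀ e ∈ G.edgeSet,
    List.Chain' (· ≤ ·) ((Γ.arc e).map Prod.snd) ∨
    List.Chain' (· ≥ ·) ((Γ.arc e).map Prod.snd)

/-- The drawing has height `h`: every vertex and every bend has an integer
`y`-coordinate in `{1, …, h}`. -/
def HasHeight (Γ : PolyDrawing G) (h : ℕ) : Prop :=
  (∀ v : V, ∃ k : ℤ, 1 ≤ k ∧ k ≤ (h : ℤ) ∧ (Γ.pos v).2 = (k : ℝ)) ∧
  (∀ e ∈ G.edgeSet, ∀ p ∈ chainBends (Γ.arc e), ∃ k : ℤ, 1 ≤ k ∧ k ≤ (h : ℤ) ∧ p.2 = (k : ℝ))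

/-- All vertices and bends have integer `y`-coordinates. -/
def IntegerY (Γ : PolyDrawing G) : Prop :=
  (∀ v : V, ∃ k : ℤ, (Γ.pos v).2 = (k : ℝ)) ∧
  (∀ e ∈ G.edgeSet, ∀ p ∈ chainBends (Γ.arc e), ∃ k : ℤ, p.2 = (k : ℝ))

/-- The set of all points of the drawing (vertex points and edge arcs). -/
def image (Γ : PolyDrawing G) : Set Pt :=
  Set.range Γ.pos ∪ ⋃ e ∈ G.edgeSet, Γ.edgePts e

/-- The union of the unbounded connected components of the complement of the drawing. -/
def outerRegion (Γ : PolyDrawing G) : Set Pt :=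
  {p | p ∉ Γ.image ∧ ¬ Bornology.IsBounded (connectedComponentIn Γ.imageᶜ p)}

/-- A vertex is inner if its point does not lie on the boundary of the unbounded
connected component of the complement of the drawing. -/
def IsInner (Γ : PolyDrawing G) (v : V) : Prop :=
  Γ.pos v ∉ frontier Γ.outerRegion

/-- Number of incoming edges at `v` (edges whose other endpoint is weakly below `v`;
horizontal edges count as incoming). -/
def indeg (Γ : PolyDrawing G) (v : V) : ℕ :=
  {w : V | G.Adj v w ∧ (Γ.pos w).2 ≤ (Γ.pos v).2}.ncard

/-- Number of outgoing edges at `v` (edges whose other endpoint is weakly above `v`;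
horizontal edges count as outgoing). -/
def outdeg (Γ : PolyDrawing G) (v : V) : ℕ :=
  {w : V | G.Adj v w ∧ (Γ.pos v).2 ≤ (Γ.pos w).2}.ncard

/-- The set of points drawn for an element (vertex or edge) of the graph. -/
def drawSet (Γ : PolyDrawing G) : V ⊕ ↥G.edgeSet → Set Pt
  | Sum.inl v => {Γ.pos v}
  | Sum.inr e => Γ.edgePts e

end PolyDrawing

/-- A straight-line drawing of a simple graph: an injective placement of the vertices;
each edge is drawn as the closed segment between its endpoints. -/
structure StraightDrawing {V : Type} (G : SimpleGraph V) where
  pos : V → Pt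
  pos_inj : Function.Injective pos

namespace StraightDrawing

variable {V : Type} {G : SimpleGraph V}

/-- The closed segment representing an edge. -/
def edgePts (Γ : StraightDrawing G) (e : Sym2 V) : Set Pt :=
  Sym2.lift ⟨fun u v => segment ℝ (Γ.pos u) (Γ.pos v),
    fun u v => segment_symm (𝕜 := ℝ) (Γ.pos u) (Γ.pos v)⟩ e

/-- Planarity of a straight-line drawing. -/
def IsPlanar (Γ : StraightDrawing G) : Prop :=
  (∀ v : V, ∀ e ∈ G.edgeSet, v ∉ e → Γ.pos v ∉ Γ.edgePts e) ∧
  (∀ e ∈ G.edgeSet, ∀ f ∈ G.edgeSet, e ≠ f →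
    ∀ p ∈ Γ.edgePts e ∩ Γ.edgePts f, ∃ w : V, w ∈ e ∧ w ∈ f ∧ p = Γ.pos w)

/-- Every vertex has an integer `y`-coordinate in `{1, …, h}`. -/
def HeightLe (Γ : StraightDrawing G) (h : ℕ) : Prop :=
  ∀ v : V, ∃ k : ℤ, 1 ≤ k ∧ k ≤ (h : ℤ) ∧ (Γ.pos v).2 = (k : ℝ)

/-- All vertices lie on integer grid points. -/
def IsGrid (Γ : StraightDrawing G) : Prop :=
  ∀ v : V, ∃ p : ℤ × ℤ, Γ.pos v = ((p.1 : ℝ), (p.2 : ℝ))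

/-- The set of points drawn for an element (vertex or edge) of the graph. -/
def drawSet (Γ : StraightDrawing G) : V ⊕ ↥G.edgeSet → Set Pt
  | Sum.inl v => {Γ.pos v}
  | Sum.inr e => Γ.edgePts e

end StraightDrawing

/-- The intersection of a set of points with the horizontal line `y = r`,
recorded as a set of `x`-coordinates. -/
def rowSlice (S : Set Pt) (r : ℝ) : Set ℝ := {x : ℝ | (x, r) ∈ S}

/-- Two drawings (given by the sets drawn for each vertex/edge element) have the same
left-to-right order in each row: for every integer row `r` and elements `a`, `b` both
meeting row `r` in both drawings, the drawing of `a` lies entirely strictly to the left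
of that of `b` in one drawing iff it does in the other. -/
def SameRowOrder {α : Type} (D D' : α → Set Pt) : Prop :=
  ∀ r : ℤ, ∀ a b : α,
    (rowSlice (D a) (r : ℝ)).Nonempty → (rowSlice (D b) (r : ℝ)).Nonempty →
    (rowSlice (D' a) (r : ℝ)).Nonempty → (rowSlice (D' b) (r : ℝ)).Nonempty →
    ((∀ x ∈ rowSlice (D a) (r : ℝ), ∀ y ∈ rowSlice (D b) (r : ℝ), x < y) ↔
     (∀ x ∈ rowSlice (D' a) (r : ℝ), ∀ y ∈ rowSlice (D' b) (r : ℝ), x < y))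

/-- A simple graph on `n ≥ 3` vertices is triangulated (maximal planar) if it admits a
planar poly-line drawing and has exactly `3n - 6` edges. -/
def IsTriangulated {V : Type} [Fintype V] (G : SimpleGraph V) : Prop :=
  3 ≤ Fintype.card V ∧ G.edgeSet.ncard = 3 * Fintype.card V - 6 ∧
  ∃ Γ : PolyDrawing G, Γ.IsPlanar

/-- Data of a flat visibility representation: a horizontal segment for every vertex
(given by its `y`-coordinate and left/right `x`-coordinates) and a segment (given by
its two endpoints) for every edge. -/
structure VisData (V : Type) where
  ly : V → ℝ
  lx : V → ℝ
  rx : V → ℝ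
  ep1 : Sym2 V → Pt
  ep2 : Sym2 V → Pt

/-- The horizontal segment of a vertex. -/
def VisData.vseg {V : Type} (D : VisData V) (v : V) : Set Pt :=
  segment ℝ (D.lx v, D.ly v) (D.rx v, D.ly v)

/-- The segment of an edge. -/
def VisData.eseg {V : Type} (D : VisData V) (e : Sym2 V) : Set Pt :=
  segment ℝ (D.ep1 e) (D.ep2 e)

/-- `D` is a planar flat visibility representation of `G` of height `h`. -/
def IsFlatVisRep {V : Type} (G : SimpleGraph V) (D : VisData V) (h : ℕ) : Prop :=
  (∀ v : V, D.lx v ≤ D.rx v) ∧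
  (∀ v : V, ∃ k : ℤ, 1 ≤ k ∧ k ≤ (h : ℤ) ∧ D.ly v = (k : ℝ)) ∧
  (∀ e ∈ G.edgeSet, (D.ep1 e).1 = (D.ep2 e).1 ∨ (D.ep1 e).2 = (D.ep2 e).2) ∧
  (∀ e ∈ G.edgeSet, ∀ p ∈ D.eseg e, 1 ≤ p.2 ∧ p.2 ≤ (h : ℝ)) ∧
  (∀ u v : V, G.Adj u v →
    (D.ep1 s(u, v) ∈ D.vseg u ∧ D.ep2 s(u, v) ∈ D.vseg v) ∨
    (D.ep1 s(u, v) ∈ D.vseg v ∧ D.ep2 s(u, v) ∈ D.vseg u)) ∧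
  (∀ u v : V, u ≠ v → Disjoint (D.vseg u) (D.vseg v)) ∧
  (∀ e ∈ G.edgeSet, ∀ w : V, ∀ p ∈ D.eseg e ∩ D.vseg w, p = D.ep1 e ∨ p = D.ep2 e) ∧
  (∀ e ∈ G.edgeSet, ∀ f ∈ G.edgeSet, e ≠ f → ∀ p ∈ D.eseg e ∩ D.eseg f,
    (p = D.ep1 e ∨ p = D.ep2 e) ∧ (p = D.ep1 f ∨ p = D.ep2 f))

end

namespace OuterPlanar

variable {V : Type}

/-- The segment drawn for an edge when the vertices are placed by `p`. -/
def edgeSeg (p : V → Pt) (e : Sym2 V) : Set Pt :=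
  Sym2.lift ⟨fun u v => segment ℝ (p u) (p v),
    fun u v => segment_symm (𝕜 := ℝ) (p u) (p v)⟩ e

@[simp] lemma edgeSeg_mk (p : V → Pt) (u v : V) :
    edgeSeg p s(u, v) = segment ℝ (p u) (p v) := rfl

/-- The placement `p` is injective on `W` and draws the edges `F` without crossings. -/
def Emb (p : V → Pt) (W : Set V) (F : Set (Sym2 V)) : Prop :=
  InjOn p W ∧ ∀ e ∈ F, ∀ f ∈ F, e ≠ f → ∀ z, z ∈ edgeSeg p e → z ∈ edgeSeg p f →
    ∃ w, w ∈ e ∧ w ∈ f ∧ z = p w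

/-- Triangulated polygons: `TriangPoly a b W F m` says that `F` is the set of edges of a
triangulated polygon with vertex set `W`, root edge `ab` and `m` further sides
(a single edge being a degenerate polygon with `m = 1`). -/
inductive TriangPoly : V → V → Set V → Set (Sym2 V) → ℕ → Prop
  | edge {a b : V} (h : a ≠ b) : TriangPoly a b {a, b} {s(a, b)} 1
  | node {a b c : V} {W₁ W₂ : Set V} {F₁ F₂ : Set (Sym2 V)} {m₁ m₂ : ℕ}
      (h₁ : TriangPoly a c W₁ F₁ m₁) (h₂ : TriangPoly c b W₂ F₂ m₂) (hW : W₁ ∩ W₂ = {c}) :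
      TriangPoly a b (W₁ ∪ W₂) (F₁ ∪ F₂ ∪ {s(a, b)}) (m₁ + m₂)

namespace TriangPoly

variable {a b : V} {W : Set V} {F : Set (Sym2 V)} {m : ℕ}

lemma left_mem (h : TriangPoly a b W F m) : a ∈ W := by
  induction h with
  | edge h => simp
  | node _ _ _ ih₁ _ => exact Or.inl ih₁

lemma right_mem (h : TriangPoly a b W F m) : b ∈ W := by
  induction h with
  | edge h => simp
  | node _ _ _ _ ih₂ => exact Or.inr ih₂

lemma symm (h : TriangPoly a b W F m) : TriangPoly b a W F m := by
  induction h with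
  | edge h => rw [Set.pair_comm, Sym2.eq_swap]; exact edge h.symm
  | @node _ _ _ W₁ W₂ F₁ F₂ _ _ _ _ hW ih₁ ih₂ =>
    rw [Set.union_comm, Set.union_comm F₁ F₂, Sym2.eq_swap, add_comm]
    exact node ih₂ ih₁ (by rw [Set.inter_comm, hW])

lemma ne (h : TriangPoly a b W F m) : a ≠ b := by
  induction h with
  | edge h => exact h
  | node h₁ h₂ hW ih₁ ih₂ =>
    rintro rfl
    exact ih₁ (hW.subset ⟨h₁.left_mem, h₂.right_mem⟩)

lemma pos (h : TriangPoly a b W F m) : 1 ≤ m := by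
  induction h with
  | edge h => exact le_rfl
  | node _ _ _ _ _ => omega

lemma mem_of_mem (h : TriangPoly a b W F m) {e : Sym2 V} (he : e ∈ F) {v : V} (hv : v ∈ e) :
    v ∈ W := by
  induction h with
  | edge h =>
    rw [Set.mem_singleton_iff] at he
    subst he
    simpa using hv
  | node h₁ h₂ hW ih₁ ih₂ =>
    rcases he with (he | he) | he
    · exact Or.inl (ih₁ he)
    · exact Or.inr (ih₂ he)
    · rw [Set.mem_singleton_iff] at he
      subst he
      rcases Sym2.mem_iff.1 hv with rfl | rfl
      · exact Or.inl h₁.left_mem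
      · exact Or.inr h₂.right_mem

lemma exists_edge (h : TriangPoly a b W F m) {v : V} (hv : v ∈ W) : ∃ e ∈ F, v ∈ e := by
  induction h with
  | edge h => exact ⟨_, rfl, by simpa using hv⟩
  | node h₁ h₂ hW ih₁ ih₂ =>
    rcases hv with hv | hv
    · obtain ⟨e, he, h⟩ := ih₁ hv
      exact ⟨e, Or.inl (Or.inl he), h⟩
    · obtain ⟨e, he, h⟩ := ih₂ hv
      exact ⟨e, Or.inl (Or.inr he), h⟩

/-- In a crossing-free placement a vertex lies only on the edges incident to it. -/
lemma mem_of_pos_mem (h : TriangPoly a b W F m) {p : V → Pt} (hp : Emb p W F) {v : V}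
    (hv : v ∈ W) {e : Sym2 V} (he : e ∈ F) (hz : p v ∈ edgeSeg p e) : v ∈ e := by
  by_contra hve
  obtain ⟨f, hf, hvf⟩ := h.exists_edge hv
  have hne : e ≠ f := by rintro rfl; exact hve hvf
  have hzf : p v ∈ edgeSeg p f := by
    induction f with
    | _ x y =>
      rcases Sym2.mem_iff.1 hvf with rfl | rfl
      · exact left_mem_segment ℝ _ _
      · exact right_mem_segment ℝ _ _
  obtain ⟨w, hwe, -, hw⟩ := hp.2 e he f hf hne _ hz hzf
  rw [hp.1 hv (h.mem_of_mem he hwe) hw] at hve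
  exact hve hwe

end TriangPoly

lemma fst_snd_of_mem_segment {u v z : Pt} (hz : z ∈ segment ℝ u v) :
    ∃ s t : ℝ, 0 ≤ s ∧ 0 ≤ t ∧ s + t = 1 ∧ z.1 = s * u.1 + t * v.1 ∧ z.2 = s * u.2 + t * v.2 := by
  obtain ⟨s, t, hs, ht, hst, rfl⟩ := hz
  exact ⟨s, t, hs, ht, hst, by simp, by simp⟩

/-- Two segments on the two sides of a line that can only touch it jointly in `c`. -/
lemma eq_of_mem_segment_of_separated {x x' y y' c z : Pt} (α β γ : ℝ)
    (hx : α * x.1 + β * x.2 ≤ γ) (hx' : α * x'.1 + β * x'.2 ≤ γ)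
    (hy : y ≠ c → γ < α * y.1 + β * y.2) (hy' : y' ≠ c → γ < α * y'.1 + β * y'.2)
    (hc : α * c.1 + β * c.2 = γ)
    (h : z ∈ segment ℝ x x') (h' : z ∈ segment ℝ y y') : z = c := by
  obtain ⟨s, t, hs, ht, hst, h1, h2⟩ := fst_snd_of_mem_segment h
  have hz : α * z.1 + β * z.2 ≤ γ := by
    have hγ : γ = s * γ + t * γ := by rw [← add_mul, hst, one_mul]
    rw [h1, h2, hγ]
    nlinarith [mul_le_mul_of_nonneg_left hx hs, mul_le_mul_of_nonneg_left hx' ht]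
  obtain ⟨s, t, hs, ht, hst, rfl⟩ := h'
  by_cases hyc : y = c
  · subst hyc
    by_cases hyc' : y' = y
    · subst hyc'
      rw [← add_smul, hst, one_smul]
    · have := hy' hyc'
      have ht0 : t = 0 := by
        by_contra hne
        have htp := lt_of_le_of_ne ht (Ne.symm hne)
        simp only [Prod.fst_add, Prod.snd_add, Prod.smul_fst, Prod.smul_snd, smul_eq_mul] at hz
        obtain rfl : s = 1 - t := by linarith
        nlinarith [mul_lt_mul_of_pos_left this htp]
      subst ht0
      obtain rfl : s = 1 := by linarith
      simp
  · have hyγ := hy hyc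
    have hyγ' : γ ≤ α * y'.1 + β * y'.2 := by
      by_cases hyc' : y' = c
      · rw [hyc', hc]
      · exact (hy' hyc').le
    have hs0 : s = 0 := by
      by_contra hne
      have hsp := lt_of_le_of_ne hs (Ne.symm hne)
      simp only [Prod.fst_add, Prod.snd_add, Prod.smul_fst, Prod.smul_snd, smul_eq_mul] at hz
      obtain rfl : t = 1 - s := by linarith
      nlinarith [mul_lt_mul_of_pos_left hyγ hsp, mul_le_mul_of_nonneg_left hyγ' ht]
    subst hs0
    obtain rfl : t = 1 := by linarith
    by_cases hyc' : y' = c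
    · simp [hyc']
    · have := hy' hyc'
      simp only [zero_smul, one_smul, zero_add] at hz
      linarith

/-- The vertices of `X` and `Y` lie on the two sides of a line through the vertex `c`, the
line meeting `Y` in no other vertex. -/
def Sep (p : V → Pt) (X Y : Set V) (c : V) : Prop :=
  ∃ α β γ : ℝ, (∀ v ∈ X, α * (p v).1 + β * (p v).2 ≤ γ) ∧
    (∀ v ∈ Y, v ≠ c → γ < α * (p v).1 + β * (p v).2) ∧ α * (p c).1 + β * (p c).2 = γ

lemma Sep.eq {p : V → Pt} {X Y : Set V} {c : V} (h : Sep p X Y c) {e f : Sym2 V}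
    (he : ∀ v ∈ e, v ∈ X) (hf : ∀ v ∈ f, v ∈ Y) {z : Pt} (hze : z ∈ edgeSeg p e)
    (hzf : z ∈ edgeSeg p f) : z = p c := by
  obtain ⟨α, β, γ, hX, hY, hc⟩ := h
  induction e with
  | _ x x' =>
    induction f with
    | _ y y' =>
      exact eq_of_mem_segment_of_separated α β γ (hX _ (he _ (by simp))) (hX _ (he _ (by simp)))
        (fun h => hY _ (hf _ (by simp)) fun h' => h (by rw [h']))
        (fun h => hY _ (hf _ (by simp)) fun h' => h (by rw [h'])) hc hze hzf

lemma Emb.glue {p : V → Pt} {a b c : V} {W₁ W₂ : Set V} {F₁ F₂ : Set (Sym2 V)} {m₁ m₂ : ℕ}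
    (t₁ : TriangPoly a c W₁ F₁ m₁) (t₂ : TriangPoly c b W₂ F₂ m₂)
    (h₁ : Emb p W₁ F₁) (h₂ : Emb p W₂ F₂) (s : Sep p W₁ W₂ c)
    (s₁ : Sep p {a, b} W₁ a) (s₂ : Sep p {a, b} W₂ b) :
    Emb p (W₁ ∪ W₂) (F₁ ∪ F₂ ∪ {s(a, b)}) := by
  have key : ∀ v ∈ W₁, ∀ w ∈ W₂, p v = p w → v = w := by
    intro v hv w hw hvw
    have hc : p v = p c := s.eq (e := s(v, v)) (f := s(w, w)) (by simpa using hv)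
      (by simpa using hw) (by simp) (by simp [hvw])
    rw [h₁.1 hv t₁.right_mem hc, h₂.1 hw t₂.left_mem (hvw ▸ hc)]
  have e12 : ∀ e ∈ F₁, ∀ f ∈ F₂, ∀ z, z ∈ edgeSeg p e → z ∈ edgeSeg p f →
      ∃ w, w ∈ e ∧ w ∈ f ∧ z = p w := by
    intro e he f hf z hze hzf
    have hz := s.eq (fun v hv => t₁.mem_of_mem he hv) (fun v hv => t₂.mem_of_mem hf hv) hze hzf
    subst hz
    exact ⟨c, t₁.mem_of_pos_mem h₁ t₁.right_mem he hze, t₂.mem_of_pos_mem h₂ t₂.left_mem hf hzf,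
      rfl⟩
  have e1 : ∀ e ∈ F₁, ∀ z, z ∈ edgeSeg p e → z ∈ edgeSeg p s(a, b) →
      ∃ w, w ∈ e ∧ w ∈ s(a, b) ∧ z = p w := by
    intro e he z hze hzf
    have hz := s₁.eq (fun v hv => by simpa using hv) (fun v hv => t₁.mem_of_mem he hv) hzf hze
    subst hz
    exact ⟨a, t₁.mem_of_pos_mem h₁ t₁.left_mem he hze, by simp, rfl⟩
  have e2 : ∀ e ∈ F₂, ∀ z, z ∈ edgeSeg p e → z ∈ edgeSeg p s(a, b) →
      ∃ w, w ∈ e ∧ w ∈ s(a, b) ∧ z = p w := by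
    intro e he z hze hzf
    have hz := s₂.eq (fun v hv => by simpa using hv) (fun v hv => t₂.mem_of_mem he hv) hzf hze
    subst hz
    exact ⟨b, t₂.mem_of_pos_mem h₂ t₂.right_mem he hze, by simp, rfl⟩
  refine ⟨?_, ?_⟩
  · rintro v (hv | hv) w (hw | hw) hvw
    · exact h₁.1 hv hw hvw
    · exact key v hv w hw hvw
    · exact (key w hw v hv hvw.symm).symm
    · exact h₂.1 hv hw hvw
  · rintro e ((he | he) | rfl) f ((hf | hf) | rfl) hef z hze hzf
    · exact h₁.2 e he f hf hef z hze hzf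
    · exact e12 e he f hf z hze hzf
    · exact e1 e he z hze hzf
    · obtain ⟨w, h, h', h''⟩ := e12 f hf e he z hzf hze
      exact ⟨w, h', h, h''⟩
    · exact h₂.2 e he f hf hef z hze hzf
    · exact e2 e he z hze hzf
    · obtain ⟨w, h, h', h''⟩ := e1 f hf z hzf hze
      exact ⟨w, h', h, h''⟩
    · obtain ⟨w, h, h', h''⟩ := e2 f hf z hzf hze
      exact ⟨w, h', h, h''⟩
    · exact absurd rfl hef

lemma Emb.congr {p q : V → Pt} {a b : V} {W : Set V} {F : Set (Sym2 V)} {m : ℕ}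
    (t : TriangPoly a b W F m) (h : Emb q W F) (hpq : ∀ v ∈ W, p v = q v) : Emb p W F := by
  have hs : ∀ e ∈ F, edgeSeg p e = edgeSeg q e := by
    intro e he
    induction e with
    | _ x y =>
      rw [edgeSeg_mk, edgeSeg_mk, hpq x (t.mem_of_mem he (by simp)),
        hpq y (t.mem_of_mem he (by simp))]
  refine ⟨h.1.congr fun v hv => (hpq v hv).symm, fun e he f hf hef z hze hzf => ?_⟩
  rw [hs e he] at hze
  rw [hs f hf] at hzf
  obtain ⟨w, hwe, hwf, hw⟩ := h.2 e he f hf hef z hze hzf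
  exact ⟨w, hwe, hwf, hw.trans (hpq w (t.mem_of_mem he hwe)).symm⟩

/-- An affine map of the plane sending horizontal lines at integer height to such lines. -/
def rowMap (α β γ : ℝ) (ε δ : ℤ) (z : Pt) : Pt :=
  (α * z.1 + β * z.2 + γ, ε * z.2 + δ)

lemma rowMap_injective {α β γ : ℝ} {ε δ : ℤ} (hα : α ≠ 0) (hε : ε ≠ 0) :
    Function.Injective (rowMap α β γ ε δ) := by
  rintro ⟨x, y⟩ ⟨x', y'⟩ h
  simp only [rowMap, Prod.mk.injEq] at h
  obtain ⟨h1, h2⟩ := h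
  have hε' : (ε : ℝ) ≠ 0 := by exact_mod_cast hε
  have hy : y = y' := mul_left_cancel₀ hε' (by linarith)
  subst hy
  have hx : x = x' := mul_left_cancel₀ hα (by linarith)
  rw [hx]

lemma exists_of_mem_edgeSeg_rowMap {α β γ : ℝ} {ε δ : ℤ} {p : V → Pt} {e : Sym2 V} {z : Pt}
    (hz : z ∈ edgeSeg (fun v => rowMap α β γ ε δ (p v)) e) :
    ∃ w ∈ edgeSeg p e, rowMap α β γ ε δ w = z := by
  induction e with
  | _ x y =>
    obtain ⟨s, t, hs, ht, hst, rfl⟩ := hz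
    refine ⟨s • p x + t • p y, ⟨s, t, hs, ht, hst, rfl⟩, ?_⟩
    obtain rfl : t = 1 - s := by linarith
    ext <;> simp [rowMap] <;> ring

lemma Emb.map {p : V → Pt} {W : Set V} {F : Set (Sym2 V)} (h : Emb p W F)
    {α β γ : ℝ} {ε δ : ℤ} (hα : α ≠ 0) (hε : ε ≠ 0) :
    Emb (fun v => rowMap α β γ ε δ (p v)) W F := by
  have hinj := rowMap_injective (β := β) (γ := γ) (δ := δ) hα hε
  refine ⟨fun v hv w hw hvw => h.1 hv hw (hinj hvw), fun e he f hf hef z hze hzf => ?_⟩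
  obtain ⟨z₁, hz₁, rfl⟩ := exists_of_mem_edgeSeg_rowMap hze
  obtain ⟨z₂, hz₂, h₂⟩ := exists_of_mem_edgeSeg_rowMap hzf
  rw [hinj h₂] at hz₂
  obtain ⟨w, hwe, hwf, hw⟩ := h.2 e he f hf hef z₁ hz₁ hz₂
  exact ⟨w, hwe, hwf, by rw [hw]⟩

/-- There is a crossing-free placement of `W` on integer rows with `a` at `A`, `b` at `B` and
all other vertices in the region `R`. -/
def Drawable (A B : Pt) (R : ℝ → ℝ → Prop) (a b : V) (W : Set V) (F : Set (Sym2 V)) : Prop :=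
  ∃ p : V → Pt, Emb p W F ∧ (∀ v ∈ W, ∃ k : ℤ, (p v).2 = k) ∧ p a = A ∧ p b = B ∧
    ∀ v ∈ W, v ≠ a → v ≠ b → R (p v).1 (p v).2

namespace Drawable

variable {A B C : Pt} {R R₁ R₂ : ℝ → ℝ → Prop} {a b c : V} {W W₁ W₂ : Set V}
  {F F₁ F₂ : Set (Sym2 V)} {m₁ m₂ : ℕ}

lemma symm (h : Drawable A B R a b W F) : Drawable B A R b a W F := by
  obtain ⟨p, h1, h2, h3, h4, h5⟩ := h
  exact ⟨p, h1, h2, h4, h3, fun v hv hb ha => h5 v hv ha hb⟩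

lemma map (h : Drawable A B R₁ a b W F) {A' B' : Pt} (α β γ : ℝ) (ε δ : ℤ) (hα : α ≠ 0)
    (hε : ε ≠ 0) (hA : rowMap α β γ ε δ A = A') (hB : rowMap α β γ ε δ B = B')
    (hR : ∀ x y : ℝ, R₁ x y → R (α * x + β * y + γ) (ε * y + δ)) : Drawable A' B' R a b W F := by
  obtain ⟨p, h1, h2, h3, h4, h5⟩ := h
  refine ⟨fun v => rowMap α β γ ε δ (p v), h1.map hα hε, ?_, by simp only [h3, hA],
    by simp only [h4, hB], fun v hv ha hb => hR _ _ (h5 v hv ha hb)⟩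
  intro v hv
  obtain ⟨k, hk⟩ := h2 v hv
  exact ⟨ε * k + δ, by simp [rowMap, hk]⟩

lemma edge (A B : Pt) (R : ℝ → ℝ → Prop) (hab : a ≠ b) (hAB : A ≠ B) (hA : ∃ k : ℤ, A.2 = k)
    (hB : ∃ k : ℤ, B.2 = k) : Drawable A B R a b {a, b} {s(a, b)} := by
  classical
  refine ⟨fun v => if v = a then A else B, ⟨?_, ?_⟩, ?_, by simp, by simp [hab.symm], ?_⟩
  · rintro v (rfl | rfl) w (rfl | rfl) h
    · rfl
    · exact absurd (by simpa [hab.symm] using h) hAB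
    · exact absurd (by simpa [hab.symm] using h.symm) hAB
    · rfl
  · rintro e rfl f rfl h
    exact absurd rfl h
  · rintro v (rfl | rfl) <;> simp [hA, hB, hab.symm]
  · rintro v (rfl | rfl) <;> simp

/-- Two drawings sharing the point `C` and separated by suitable lines combine. -/
lemma glue (t₁ : TriangPoly a c W₁ F₁ m₁) (t₂ : TriangPoly c b W₂ F₂ m₂) (hW : W₁ ∩ W₂ = {c})
    (h₁ : Drawable A C R₁ a c W₁ F₁) (h₂ : Drawable C B R₂ c b W₂ F₂)
    (hR₁ : ∀ x y, R₁ x y → R x y) (hR₂ : ∀ x y, R₂ x y → R x y) (hC : R C.1 C.2)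
    (α β γ : ℝ) (hsA : α * A.1 + β * A.2 ≤ γ) (hsC : α * C.1 + β * C.2 = γ)
    (hsB : γ < α * B.1 + β * B.2) (hs₁ : ∀ x y, R₁ x y → α * x + β * y ≤ γ)
    (hs₂ : ∀ x y, R₂ x y → γ < α * x + β * y)
    (α' β' γ' : ℝ) (hsA' : α' * A.1 + β' * A.2 = γ') (hsC' : γ' < α' * C.1 + β' * C.2)
    (hsB' : α' * B.1 + β' * B.2 = γ') (hs₁' : ∀ x y, R₁ x y → γ' < α' * x + β' * y)
    (hs₂' : ∀ x y, R₂ x y → γ' < α' * x + β' * y) :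
    Drawable A B R a b (W₁ ∪ W₂) (F₁ ∪ F₂ ∪ {s(a, b)}) := by
  classical
  obtain ⟨q₁, e₁, z₁, a₁, c₁, r₁⟩ := h₁
  obtain ⟨q₂, e₂, z₂, c₂, b₂, r₂⟩ := h₂
  obtain ⟨p, hp₁, hp₂⟩ : ∃ p : V → Pt, (∀ v ∈ W₁, p v = q₁ v) ∧ ∀ v ∈ W₂, p v = q₂ v := by
    refine ⟨fun v => if v ∈ W₁ then q₁ v else q₂ v, fun v hv => by simp [hv], fun v hv => ?_⟩
    by_cases hv' : v ∈ W₁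
    · obtain rfl : v = c := hW.subset ⟨hv', hv⟩
      simp [hv', c₁, c₂]
    · simp [hv']
  have pa : p a = A := by rw [hp₁ a t₁.left_mem, a₁]
  have pc : p c = C := by rw [hp₁ c t₁.right_mem, c₁]
  have pb : p b = B := by rw [hp₂ b t₂.right_mem, b₂]
  have v₁ : ∀ v ∈ W₁, v = a ∨ v = c ∨ R₁ (p v).1 (p v).2 := by
    intro v hv
    rw [hp₁ v hv]
    exact or_iff_not_imp_left.2 fun ha => or_iff_not_imp_left.2 fun hc => r₁ v hv ha hc
  have v₂ : ∀ v ∈ W₂, v = c ∨ v = b ∨ R₂ (p v).1 (p v).2 := by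
    intro v hv
    rw [hp₂ v hv]
    exact or_iff_not_imp_left.2 fun ha => or_iff_not_imp_left.2 fun hc => r₂ v hv ha hc
  refine ⟨p, Emb.glue t₁ t₂ (e₁.congr t₁ hp₁) (e₂.congr t₂ hp₂) ⟨α, β, γ, ?_, ?_, ?_⟩
    ⟨α', β', γ', ?_, ?_, ?_⟩ ⟨α', β', γ', ?_, ?_, ?_⟩, ?_, pa, pb, ?_⟩
  · intro v hv
    rcases v₁ v hv with rfl | rfl | h
    · rwa [pa]
    · rw [pc, hsC]
    · exact hs₁ _ _ h
  · intro v hv hne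
    rcases v₂ v hv with rfl | rfl | h
    · exact absurd rfl hne
    · rwa [pb]
    · exact hs₂ _ _ h
  · rwa [pc]
  · rintro v (rfl | rfl)
    · rw [pa, hsA']
    · rw [pb, hsB']
  · intro v hv hne
    rcases v₁ v hv with rfl | rfl | h
    · exact absurd rfl hne
    · rwa [pc]
    · exact hs₁' _ _ h
  · rwa [pa]
  · rintro v (rfl | rfl)
    · rw [pa, hsA']
    · rw [pb, hsB']
  · intro v hv hne
    rcases v₂ v hv with rfl | rfl | h
    · rwa [pc]
    · exact absurd rfl hne
    · exact hs₂' _ _ h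
  · rwa [pb]
  · rintro v (hv | hv)
    · rw [hp₁ v hv]; exact z₁ v hv
    · rw [hp₂ v hv]; exact z₂ v hv
  · rintro v (hv | hv) ha hb
    · rcases v₁ v hv with rfl | rfl | h
      · exact absurd rfl ha
      · rwa [pc]
      · exact hR₁ _ _ h
    · rcases v₂ v hv with rfl | rfl | h
      · rwa [pc]
      · exact absurd rfl hb
      · exact hR₂ _ _ h

end Drawable

/-- Drawings in a triangle of height `H` above the horizontal root edge. -/
def TriDrawable (H : ℤ) : V → V → Set V → Set (Sym2 V) → Prop :=
  Drawable (0, 0) (1, 0) fun x y => 0 < x ∧ 1 ≤ y ∧ y + 1 ≤ H ∧ H * x + y < H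

/-- Drawings in a strip of height `H` crossed by the root edge, all vertices other than the
ends of the root edge being in the rows `r, …, H`. -/
def StripDrawable (r : ℝ) (H : ℤ) : V → V → Set V → Set (Sym2 V) → Prop :=
  Drawable (0, 0) (0, H) fun x y => 0 < x ∧ x < 1 ∧ r ≤ y ∧ y ≤ H

/-- Drawings in a triangle of height `H` in which the first end of the root edge is the only
vertex of the bottom row and the second one is in the next row. -/
def FanDrawable (H : ℤ) : V → V → Set V → Set (Sym2 V) → Prop :=
  Drawable (0, 0) (1, 1) fun x y => 0 < x ∧ 1 ≤ y ∧ (H - 1) * x + y < H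

variable {a b c : V} {W W₁ W₂ : Set V} {F F₁ F₂ : Set (Sym2 V)} {m₁ m₂ : ℕ} {H : ℤ} {r : ℝ}

lemma TriDrawable.edge (hab : a ≠ b) : TriDrawable H a b {a, b} {s(a, b)} :=
  Drawable.edge _ _ _ hab (by simp) ⟨0, by simp⟩ ⟨0, by simp⟩

lemma StripDrawable.edge (hH : 1 ≤ H) (hab : a ≠ b) : StripDrawable r H a b {a, b} {s(a, b)} :=
  Drawable.edge _ _ _ hab
    (by have : (H : ℝ) ≠ 0 := by exact_mod_cast (by omega : H ≠ 0)
        simp [this.symm]) ⟨0, by simp⟩ ⟨H, by simp⟩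

lemma FanDrawable.edge (hab : a ≠ b) : FanDrawable H a b {a, b} {s(a, b)} :=
  Drawable.edge _ _ _ hab (by simp) ⟨0, by simp⟩ ⟨1, by simp⟩

lemma TriDrawable.symm (hH : 1 ≤ H) (h : TriDrawable H a b W F) : TriDrawable H b a W F := by
  have hH' : (1 : ℝ) ≤ H := by exact_mod_cast hH
  refine Drawable.symm (Drawable.map h (-1) (-1 / H) 1 1 0 (by simp) (by simp) (by simp [rowMap])
    (by simp [rowMap]) ?_)
  rintro x y ⟨h1, h2, h3, h4⟩
  have e : -1 * x + -1 / (H : ℝ) * y + 1 = (H - (H * x + y)) / H := by field_simp; ring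
  have e' : (H : ℝ) * ((H - (H * x + y)) / H) = H - (H * x + y) := by field_simp
  rw [e, e']
  push_cast
  refine ⟨div_pos (by linarith) (by linarith), by linarith, by linarith, ?_⟩
  nlinarith

lemma StripDrawable.symm (h : StripDrawable 0 H a b W F) : StripDrawable 0 H b a W F := by
  refine Drawable.symm (Drawable.map h 1 0 0 (-1) H (by simp) (by simp) (by simp [rowMap])
    (by simp [rowMap]) ?_)
  rintro x y ⟨h1, h2, h3, h4⟩
  push_cast
  refine ⟨?_, ?_, ?_, ?_⟩ <;> linarith

lemma TriDrawable.mono {H' : ℤ} (hH : H ≤ H') (h : TriDrawable H a b W F) :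
    TriDrawable H' a b W F := by
  have hH' : (H : ℝ) ≤ H' := by exact_mod_cast hH
  refine Drawable.map h 1 0 0 1 0 (by simp) (by simp) (by simp [rowMap]) (by simp [rowMap]) ?_
  rintro x y ⟨h1, h2, h3, h4⟩
  push_cast
  refine ⟨by linarith, by linarith, by linarith, ?_⟩
  have hx : x < 1 := by
    by_contra hx
    nlinarith
  nlinarith

/-- Hang a small drawing on the far border of a strip. -/
lemma StripDrawable.node (t₁ : TriangPoly a c W₁ F₁ m₁) (t₂ : TriangPoly c b W₂ F₂ m₂)
    (hW : W₁ ∩ W₂ = {c}) (hH : 1 ≤ H) (hr : 0 ≤ r) (hr' : r ≤ 1)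
    (h₁ : StripDrawable r H a c W₁ F₁) (h₂ : TriDrawable H c b W₂ F₂) :
    StripDrawable r H a b (W₁ ∪ W₂) (F₁ ∪ F₂ ∪ {s(a, b)}) := by
  have hH' : (1 : ℝ) ≤ H := by exact_mod_cast hH
  have hH0 : (0 : ℝ) < H := by linarith
  have g₁ : Drawable (0, 0) (1 / 2, (H : ℝ))
      (fun x y => y < 2 * H * x ∧ 0 < x ∧ x < 1 ∧ r ≤ y ∧ y ≤ H) a c W₁ F₁ := by
    refine Drawable.map h₁ (1 / 2) (1 / (2 * H)) 0 1 0 (by norm_num) (by simp)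
      (by simp [rowMap]) (by simp [rowMap]; field_simp) ?_
    rintro x y ⟨h1, h2, h3, h4⟩
    have e : 2 * (H : ℝ) * (1 / 2 * x + 1 / (2 * H) * y + 0) = H * x + y := by field_simp; ring
    have e' : 1 / 2 * x + 1 / (2 * H) * y + 0 = (x + y / H) / 2 := by field_simp; ring
    have hy : y / H ≤ 1 := by rw [div_le_one hH0]; exact h4
    have hy' : 0 ≤ y / H := div_nonneg (by linarith) hH0.le
    have := mul_pos hH0 h1
    rw [e, e']
    push_cast
    refine ⟨?_, ?_, ?_, ?_, ?_⟩ <;> linarith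
  have g₂ : Drawable (1 / 2, (H : ℝ)) (0, (H : ℝ))
      (fun x y => 2 * H * x < y ∧ 0 < x ∧ 1 ≤ y ∧ y ≤ H) c b W₂ F₂ := by
    refine Drawable.map h₂ (-1 / 2) (-1 / (2 * H)) (1 / 2) (-1) H (by norm_num) (by simp)
      (by simp [rowMap]) (by simp [rowMap]; norm_num) ?_
    rintro x y ⟨h1, h2, h3, h4⟩
    have e : -1 / 2 * x + -1 / (2 * H) * y + 1 / 2 = (H - (H * x + y)) / (2 * H) := by
      field_simp; ring
    have e' : 2 * (H : ℝ) * ((H - (H * x + y)) / (2 * H)) = H - (H * x + y) := by field_simp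
    have := mul_pos hH0 h1
    rw [e, e']
    push_cast
    refine ⟨by linarith, div_pos (by linarith) (by linarith), by linarith, by linarith⟩
  refine Drawable.glue t₁ t₂ hW g₁ g₂ (fun x y h => h.2) ?_ ?_ (-2 * H) 1 0 (by simp)
    (by simp; ring) (by simpa using hH0) ?_ ?_ 1 0 0 (by simp) (by simp) (by simp) ?_ ?_
  · rintro x y ⟨h1, h2, h3, h4⟩
    refine ⟨h2, ?_, by linarith, h4⟩
    nlinarith
  · refine ⟨by norm_num, by norm_num, by simp; linarith, by simp⟩
  · rintro x y ⟨h1, -⟩; linarith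
  · rintro x y ⟨h1, -⟩; linarith
  · rintro x y ⟨-, h1, -⟩; linarith
  · rintro x y ⟨-, h1, -⟩; linarith

lemma FanDrawable.node (t₁ : TriangPoly a c W₁ F₁ m₁) (t₂ : TriangPoly c b W₂ F₂ m₂)
    (hW : W₁ ∩ W₂ = {c}) (hH : 1 ≤ H)
    (h₁ : FanDrawable (H + 1) a c W₁ F₁) (h₂ : TriDrawable H c b W₂ F₂) :
    FanDrawable (H + 1) a b (W₁ ∪ W₂) (F₁ ∪ F₂ ∪ {s(a, b)}) := by
  have hH' : (1 : ℝ) ≤ H := by exact_mod_cast hH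
  have hH0 : (0 : ℝ) < H := by linarith
  have g₁ : Drawable (0, 0) (1 / 2, 1)
      (fun x y => 0 < x ∧ 1 ≤ y ∧ 2 * H * x + y < H + 1) a c W₁ F₁ := by
    refine Drawable.map h₁ (1 / 2) 0 0 1 0 (by norm_num) (by simp)
      (by simp [rowMap]) (by simp [rowMap]) ?_
    rintro x y ⟨h1, h2, h3⟩
    push_cast at h3 ⊢
    refine ⟨?_, ?_, ?_⟩ <;> linarith
  have g₂ : Drawable (1 / 2, 1) (1, 1)
      (fun x y => 0 < x ∧ 1 ≤ y ∧ H * x + y < H + 1 ∧ H + 1 < 2 * H * x + y) c b W₂ F₂ := by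
    refine Drawable.map h₂ (1 / 2) (-1 / (2 * H)) (1 / 2) 1 1 (by norm_num) (by simp)
      (by simp [rowMap]) (by simp [rowMap]; norm_num) ?_
    rintro x y ⟨h1, h2, h3, h4⟩
    have e : 1 / 2 * x + -1 / (2 * H) * y + 1 / 2 = (H * x + (H - y)) / (2 * H) := by
      field_simp; ring
    have e' : 2 * (H : ℝ) * ((H * x + (H - y)) / (2 * H)) = H * x + (H - y) := by field_simp
    have e2 : (H : ℝ) * ((H * x + (H - y)) / (2 * H)) = (H * x + (H - y)) / 2 := by field_simp
    have := mul_pos hH0 h1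
    rw [e, e', e2]
    push_cast
    refine ⟨div_pos (by linarith) (by linarith), ?_, ?_, ?_⟩ <;> linarith
  have hx : ∀ x y : ℝ, 1 ≤ y → H * x + y < H + 1 → x < 1 := by
    intro x y h h'
    nlinarith
  refine Drawable.glue t₁ t₂ hW g₁ g₂ ?_ ?_ ?_ (2 * H) 1 (H + 1) (by simp; linarith)
    (by simp; ring) (by simp; linarith) ?_ ?_ (-1) 1 0 (by simp) (by norm_num) (by simp) ?_ ?_
  · rintro x y ⟨h1, h2, h3⟩
    have := mul_pos hH0 h1
    push_cast
    refine ⟨h1, h2, by linarith⟩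
  · rintro x y ⟨h1, h2, h3, h4⟩
    push_cast
    refine ⟨h1, h2, by linarith⟩
  · push_cast
    refine ⟨by norm_num, by norm_num, ?_⟩
    simp; linarith
  · rintro x y ⟨-, -, h⟩; linarith
  · rintro x y ⟨-, -, -, h⟩; linarith
  · rintro x y ⟨h1, h2, h3⟩
    have := mul_pos hH0 h1
    have := hx x y h2 (by linarith)
    linarith
  · rintro x y ⟨h1, h2, h3, h4⟩
    have := hx x y h2 h3
    linarith

/-- Start a strip one row further up. -/
lemma StripDrawable.of_fan (t₁ : TriangPoly a c W₁ F₁ m₁) (t₂ : TriangPoly c b W₂ F₂ m₂)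
    (hW : W₁ ∩ W₂ = {c}) (hH : 1 ≤ H)
    (h₁ : FanDrawable (H + 1) a c W₁ F₁) (h₂ : StripDrawable 0 H c b W₂ F₂) :
    StripDrawable 1 (H + 1) a b (W₁ ∪ W₂) (F₁ ∪ F₂ ∪ {s(a, b)}) := by
  have hH' : (1 : ℝ) ≤ H := by exact_mod_cast hH
  have hH0 : (0 : ℝ) < H := by linarith
  have g₁ : Drawable (0, 0) (1 / 2, 1)
      (fun x y => 0 < x ∧ 1 ≤ y ∧ 2 * H * x + y < H + 1) a c W₁ F₁ := by
    refine Drawable.map h₁ (1 / 2) 0 0 1 0 (by norm_num) (by simp)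
      (by simp [rowMap]) (by simp [rowMap]) ?_
    rintro x y ⟨h1, h2, h3⟩
    push_cast at h3 ⊢
    refine ⟨?_, ?_, ?_⟩ <;> linarith
  have g₂ : Drawable (1 / 2, 1) (0, (H : ℝ) + 1)
      (fun x y => 0 < x ∧ x < 1 ∧ 1 ≤ y ∧ y ≤ H + 1 ∧ H + 1 ≤ 2 * H * x + y) c b W₂ F₂ := by
    refine Drawable.map h₂ (1 / 2) (-1 / (2 * H)) (1 / 2) 1 1 (by norm_num) (by simp)
      (by simp [rowMap]) (by simp [rowMap]; field_simp; norm_num) ?_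
    rintro x y ⟨h1, h2, h3, h4⟩
    have e : 1 / 2 * x + -1 / (2 * H) * y + 1 / 2 = (x + (1 - y / H)) / 2 := by
      field_simp; ring
    have e' : 2 * (H : ℝ) * ((x + (1 - y / H)) / 2) = H * x + (H - y) := by field_simp
    have hy : y / H ≤ 1 := by rw [div_le_one hH0]; exact h4
    have hy' : 0 ≤ y / H := div_nonneg (by linarith) hH0.le
    have := mul_pos hH0 h1
    rw [e, e']
    push_cast
    refine ⟨?_, ?_, ?_, ?_, ?_⟩ <;> linarith
  have g := Drawable.glue (R := fun x y => 0 < x ∧ x < 1 ∧ 1 ≤ y ∧ y ≤ H + 1) t₂.symm t₁.symm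
    (by rw [Set.inter_comm, hW]) g₂.symm g₁.symm ?_ ?_ ?_ (-2 * H) (-1) (-H - 1) (by simp; linarith)
    (by simp; linarith) (by simp; linarith) ?_ ?_ 1 0 0 (by simp) (by norm_num) (by simp) ?_ ?_
  · have := g.symm
    rw [Set.union_comm W₂, Set.union_comm F₂, Sym2.eq_swap] at this
    simpa [StripDrawable] using this
  · rintro x y ⟨h1, h2, h3, h4, h5⟩
    exact ⟨h1, h2, h3, h4⟩
  · rintro x y ⟨h1, h2, h3⟩
    have := mul_pos hH0 h1
    refine ⟨h1, ?_, h2, by linarith⟩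
    nlinarith
  · refine ⟨by norm_num, by norm_num, by norm_num, by simp; linarith⟩
  · rintro x y ⟨-, -, -, -, h⟩; linarith
  · rintro x y ⟨-, -, h⟩; linarith
  · rintro x y ⟨h, -⟩; linarith
  · rintro x y ⟨h, -⟩; linarith

lemma TriDrawable.of_strips (t₁ : TriangPoly a c W₁ F₁ m₁) (t₂ : TriangPoly c b W₂ F₂ m₂)
    (hW : W₁ ∩ W₂ = {c}) (hH : 1 ≤ H)
    (h₁ : StripDrawable 1 H a c W₁ F₁) (h₂ : StripDrawable 1 H b c W₂ F₂) :
    TriDrawable (H + 1) a b (W₁ ∪ W₂) (F₁ ∪ F₂ ∪ {s(a, b)}) := by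
  have hH' : (1 : ℝ) ≤ H := by exact_mod_cast hH
  have hH0 : (0 : ℝ) < H := by linarith
  obtain ⟨κ, hκ⟩ : ∃ κ : ℝ, κ = 1 / (2 * (H + 1)) := ⟨_, rfl⟩
  have hκ0 : 0 < κ := by rw [hκ]; positivity
  have hκ' : (H + 1) * κ = 1 / 2 := by rw [hκ]; field_simp
  have g₁ : Drawable (0, 0) (κ, (H : ℝ))
      (fun x y => 0 < x ∧ 1 ≤ y ∧ y ≤ H ∧ (H + 1) * x + y < H + 1 ∧ H * x ≤ κ * y) a c W₁ F₁ := by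
    refine Drawable.map h₁ (-κ / (2 * H)) (κ / H) 0 1 0
      (div_ne_zero (by linarith) (by linarith)) (by simp)
      (by simp [rowMap]) (by simp [rowMap]; field_simp) ?_
    rintro x y ⟨h1, h2, h3, h4⟩
    have e : -κ / (2 * H) * x + κ / H * y + 0 = κ * ((2 * y - x) / (2 * H)) := by
      field_simp; ring
    have e' : (H + 1) * (κ * ((2 * y - x) / (2 * H))) = (2 * y - x) / (2 * H) / 2 := by
      rw [← mul_assoc, hκ']; ring
    have e2 : H * (κ * ((2 * y - x) / (2 * H))) = κ * (y - x / 2) := by field_simp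
    have hle : (2 * y - x) / (2 * H) ≤ 1 := by rw [div_le_one (by linarith)]; linarith
    rw [e, e', e2]
    push_cast
    refine ⟨mul_pos hκ0 (div_pos (by linarith) (by linarith)), by linarith, by linarith,
      by linarith, mul_le_mul_of_nonneg_left (by linarith) hκ0.le⟩
  have g₂ : Drawable (1, 0) (κ, (H : ℝ))
      (fun x y => 0 < x ∧ 1 ≤ y ∧ y ≤ H ∧ (H + 1) * x + y < H + 1 ∧ κ * y < H * x) b c W₂ F₂ := by
    refine Drawable.map h₂ (κ / H) ((κ - 1) / H) 1 1 0
      (div_ne_zero (by linarith) (by linarith)) (by simp)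
      (by simp [rowMap]) (by simp [rowMap]; field_simp; ring) ?_
    rintro x y ⟨h1, h2, h3, h4⟩
    have e : κ / H * x + (κ - 1) / H * y + 1 = (κ * (x + y) + (H - y)) / H := by
      field_simp; ring
    have e' : (H + 1) * ((κ * (x + y) + (H - y)) / H) = (H + 1 - y) - (y - x) / (2 * H) := by
      have : (H + 1) * ((κ * (x + y) + (H - y)) / H)
          = (((H + 1) * κ) * (x + y) + (H + 1) * (H - y)) / H := by field_simp
      rw [this, hκ']
      field_simp
      ring
    have e2 : (H : ℝ) * ((κ * (x + y) + (H - y)) / H) = κ * (x + y) + (H - y) := by field_simp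
    have hp : 0 < (y - x) / (2 * H) := div_pos (by linarith) (by linarith)
    have hk := mul_pos hκ0 h1
    have hk' := mul_pos hκ0 (show 0 < y by linarith)
    rw [e, e', e2]
    push_cast
    refine ⟨div_pos ?_ hH0, by linarith, by linarith, by linarith, by linarith⟩
    linarith
  have g := Drawable.glue (R := fun x y => 0 < x ∧ 1 ≤ y ∧ y ≤ H ∧ (H + 1) * x + y < H + 1)
    t₁ t₂ hW g₁ g₂.symm ?_ ?_ ?_ H (-κ) 0 (by simp)
    (by simp; ring) (by simpa using hH0) ?_ ?_ 0 1 0 (by simp) (by simpa using hH0) (by simp) ?_ ?_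
  · simpa [TriDrawable] using g
  · rintro x y ⟨h1, h2, h3, h4, h5⟩
    exact ⟨h1, h2, h3, h4⟩
  · rintro x y ⟨h1, h2, h3, h4, h5⟩
    exact ⟨h1, h2, h3, h4⟩
  · refine ⟨hκ0, hH', le_rfl, ?_⟩
    simp only [hκ']
    linarith
  · rintro x y ⟨-, -, -, -, h⟩; linarith
  · rintro x y ⟨-, -, -, -, h⟩; linarith
  · rintro x y ⟨-, h, -⟩; linarith
  · rintro x y ⟨-, h, -⟩; linarith

/-- Doubling the number of sides costs two rows. -/
lemma TriDrawable.double {M : ℕ} (hH : 1 ≤ H)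
    (ih : ∀ (a b : V) (W : Set V) (F : Set (Sym2 V)) (m : ℕ), TriangPoly a b W F m → m ≤ M →
      TriDrawable H a b W F) {m : ℕ} (t : TriangPoly a b W F m) (hm : m ≤ 2 * M) :
    TriDrawable (H + 2) a b W F := by
  have strip : ∀ (a b : V) (W : Set V) (F : Set (Sym2 V)) (m : ℕ), TriangPoly a b W F m →
      m ≤ 2 * M → StripDrawable 0 H a b W F := by
    intro a b W F m t
    induction t with
    | edge h => exact fun _ => StripDrawable.edge hH h
    | @node a b c W₁ W₂ F₁ F₂ m₁ m₂ t₁ t₂ hW i₁ i₂ =>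
      intro hm
      by_cases h : m₂ ≤ M
      · exact StripDrawable.node t₁ t₂ hW hH le_rfl zero_le_one (i₁ (by omega)) (ih _ _ _ _ _ t₂ h)
      · have := StripDrawable.node t₂.symm t₁.symm (by rw [Set.inter_comm, hW]) hH le_rfl
          zero_le_one (i₂ (by omega)).symm (ih _ _ _ _ _ t₁.symm (by omega))
        rw [Set.union_comm W₂, Set.union_comm F₂, Sym2.eq_swap] at this
        exact this.symm
  have fan : ∀ (a b : V) (W : Set V) (F : Set (Sym2 V)) (m : ℕ), TriangPoly a b W F m →
      m ≤ M → FanDrawable (H + 1) a b W F := by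
    intro a b W F m t
    induction t with
    | edge h => exact fun _ => FanDrawable.edge h
    | node t₁ t₂ hW i₁ i₂ =>
      intro hm
      exact FanDrawable.node t₁ t₂ hW hH (i₁ (by omega)) (ih _ _ _ _ _ t₂ (by omega))
  have strip' : ∀ (a b : V) (W : Set V) (F : Set (Sym2 V)) (m : ℕ), TriangPoly a b W F m →
      m ≤ 2 * M → StripDrawable 1 (H + 1) a b W F := by
    intro a b W F m t
    induction t with
    | edge h => exact fun _ => StripDrawable.edge (by omega) h
    | @node a b c W₁ W₂ F₁ F₂ m₁ m₂ t₁ t₂ hW i₁ i₂ =>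
      intro hm
      by_cases h : m₂ ≤ M
      · exact StripDrawable.node t₁ t₂ hW (by omega) zero_le_one le_rfl (i₁ (by omega))
          ((ih _ _ _ _ _ t₂ h).mono (by omega))
      · exact StripDrawable.of_fan t₁ t₂ hW hH (fan _ _ _ _ _ t₁ (by omega))
          (strip _ _ _ _ _ t₂ (by omega))
  cases t with
  | edge h => exact TriDrawable.edge h
  | node t₁ t₂ hW =>
    have := TriDrawable.of_strips t₁ t₂ hW (by omega) (strip' _ _ _ _ _ t₁ (by omega))
      (strip' _ _ _ _ _ t₂.symm (by omega))
    rwa [add_assoc] at this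

lemma triDrawable_of_le_two_pow (k : ℕ) : ∀ (a b : V) (W : Set V) (F : Set (Sym2 V)) (m : ℕ),
    TriangPoly a b W F m → m ≤ 2 ^ k → TriDrawable (2 * k + 1) a b W F := by
  induction k with
  | zero =>
    intro a b W F m t hm
    cases t with
    | edge h => exact TriDrawable.edge h
    | node t₁ t₂ _ =>
      have := t₁.pos
      have := t₂.pos
      omega
  | succ k ih =>
    intro a b W F m t hm
    have := TriDrawable.double (by omega) ih t (by rw [pow_succ] at hm; omega)
    convert this using 1
    push_cast
    ring

/-- A graph without crossing edges with respect to a linear order of its vertices is contained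
in a triangulated polygon. -/
lemma exists_triangPoly (G : SimpleGraph V) {n : ℕ} {f : ℕ → V} (hf : InjOn f (Iio n))
    (hG : ∀ i j k l, i < j → j < k → k < l → l < n → G.Adj (f i) (f k) → ¬ G.Adj (f j) (f l)) :
    ∀ d i j, j - i = d → i < j → j < n → ∃ F, TriangPoly (f i) (f j) (f '' Icc i j) F (j - i) ∧
      ∀ x y, i ≤ x → x < y → y ≤ j → G.Adj (f x) (f y) → s(f x, f y) ∈ F := by
  intro d
  induction d using Nat.strong_induction_on with
  | _ d ih =>
    intro i j hd hij hj
    by_cases hij1 : j = i + 1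
    · subst hij1
      refine ⟨{s(f i, f (i + 1))}, ?_, ?_⟩
      · have h1 : f '' Icc i (i + 1) = {f i, f (i + 1)} := by
          have : Icc i (i + 1) = {i, i + 1} := by
            ext x; simp only [mem_Icc, mem_insert_iff, mem_singleton_iff]; omega
          rw [this, image_pair]
        have h2 : i + 1 - i = 1 := by omega
        rw [h1, h2]
        refine TriangPoly.edge fun h => ?_
        have := hf (show i < n by omega) (show i + 1 < n from hj) h
        omega
      · intro x y hx hxy hy _
        obtain rfl : x = i := by omega
        obtain rfl : y = x + 1 := by omega
        rfl
    · obtain ⟨k, hik, hkj, hk1, hk2⟩ : ∃ k, i < k ∧ k < j ∧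
          (k = i + 1 ∨ G.Adj (f i) (f k)) ∧ ∀ l, k < l → l < j → ¬ G.Adj (f i) (f l) := by
        classical
        let P : ℕ → Prop := fun k => i < k ∧ k < j ∧ (k = i + 1 ∨ G.Adj (f i) (f k))
        have hP : P (i + 1) := ⟨by omega, by omega, Or.inl rfl⟩
        have hle : i + 1 ≤ j := by omega
        have hs := Nat.findGreatest_spec (P := P) hle hP
        refine ⟨Nat.findGreatest P j, hs.1, hs.2.1, hs.2.2, fun l hl hlj hadj => ?_⟩
        exact Nat.findGreatest_is_greatest hl hlj.le ⟨by omega, hlj, Or.inr hadj⟩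
      obtain ⟨F₁, t₁, h₁⟩ := ih (k - i) (by omega) i k rfl hik (by omega)
      obtain ⟨F₂, t₂, h₂⟩ := ih (j - k) (by omega) k j rfl hkj hj
      refine ⟨F₁ ∪ F₂ ∪ {s(f i, f j)}, ?_, ?_⟩
      · have hI : f '' Icc i j = f '' Icc i k ∪ f '' Icc k j := by
          rw [← image_union, Icc_union_Icc_eq_Icc hik.le hkj.le]
        have hs : j - i = (k - i) + (j - k) := by omega
        rw [hI, hs]
        refine TriangPoly.node t₁ t₂ ?_
        rw [← hf.image_inter (fun x hx => lt_of_le_of_lt hx.2 (by omega))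
          (fun x hx => lt_of_le_of_lt hx.2 hj)]
        have : Icc i k ∩ Icc k j = {k} := by
          ext x; simp only [mem_inter_iff, mem_Icc, mem_singleton_iff]; omega
        rw [this, image_singleton]
      · intro x y hx hxy hy hadj
        by_cases hyk : y ≤ k
        · exact Or.inl (Or.inl (h₁ x y hx hxy hyk hadj))
        by_cases hxk : k ≤ x
        · exact Or.inl (Or.inr (h₂ x y hxk hxy hy hadj))
        rcases hx.eq_or_lt with rfl | hix
        · rcases hy.eq_or_lt with rfl | hyj
          · exact Or.inr rfl
          · exact absurd hadj (hk2 y (by omega) hyj)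
        · rcases hk1 with hk1 | hk1
          · omega
          · exact absurd hadj (hG i x k y hix (by omega) (by omega) (by omega) hk1)

/-- Twice the signed area of the triangle `uvw`. -/
def orient (u v w : Pt) : ℝ :=
  (v.1 - u.1) * (w.2 - u.2) - (v.2 - u.2) * (w.1 - u.1)

/-- No point is a convex combination of three of the others. -/
def ConvexPosition (p : V → Pt) : Prop :=
  ∀ v x y z : V, x ≠ v → y ≠ v → z ≠ v → ∀ s t r : ℝ, 0 ≤ s → 0 ≤ t → 0 ≤ r → s + t + r = 1 →
    s * (p x).1 + t * (p y).1 + r * (p z).1 = (p v).1 →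
    s * (p x).2 + t * (p y).2 + r * (p z).2 ≠ (p v).2

lemma convexPosition_of_extremePoints {p : V → Pt} (hp : Function.Injective p)
    (h : ∀ v, p v ∈ extremePoints ℝ (convexHull ℝ (range p))) : ConvexPosition p := by
  intro v x y z hx hy hz s t r hs ht hr hsum h1 h2
  have hv := (((convex_convexHull ℝ (range p)).mem_extremePoints_iff_mem_sdiff_convexHull_sdiff).1
    (h v)).2
  have hmem : ∀ u, u ≠ v → p u ∈ convexHull ℝ (convexHull ℝ (range p) \ {p v}) := fun u hu =>
    subset_convexHull ℝ _ ⟨subset_convexHull ℝ _ (mem_range_self u), fun h => hu (hp h)⟩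
  refine hv ?_
  have := (convex_convexHull ℝ (convexHull ℝ (range p) \ {p v})).sum_mem
    (t := Finset.univ) (w := ![s, t, r]) (z := ![p x, p y, p z])
    (by intro i _; fin_cases i <;> simpa) (by simpa [Fin.sum_univ_three] using hsum)
    (by intro i _; fin_cases i <;> simp [hmem, hx, hy, hz])
  convert this using 1
  ext <;> simp [Fin.sum_univ_three, ← h1, ← h2]

/-- `u` precedes `v` in the lexicographic order of the plane. -/
def LexLT (u v : Pt) : Prop := u.1 < v.1 ∨ (u.1 = v.1 ∧ u.2 < v.2)

lemma exists_lexLT_of_ne [Finite V] [Nonempty V] {p : V → Pt} (hp : Function.Injective p) :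
    ∃ a, ∀ v, v ≠ a → LexLT (p a) (p v) := by
  obtain ⟨a, ha⟩ := Finite.exists_min fun v => toLex (p v)
  refine ⟨a, fun v hv => ?_⟩
  have hlt : toLex (p a) < toLex (p v) :=
    lt_of_le_of_ne (ha v) fun h => hv (hp (toLex.injective h)).symm
  exact Prod.Lex.toLex_lt_toLex.1 hlt

lemma orient_trans {a u v w : Pt} (hu : LexLT a u) (hv : LexLT a v) (hw : LexLT a w)
    (huv : 0 < orient a u v) (hvw : 0 < orient a v w) : 0 < orient a u w := by
  unfold LexLT orient at *
  have hv1 : a.1 < v.1 := by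
    rcases hv with h | ⟨h, h'⟩
    · exact h
    · rw [← h, sub_self, zero_mul] at hvw
      have : a.1 ≤ w.1 := by rcases hw with h | h <;> linarith
      nlinarith
  have hu1 : a.1 < u.1 := by
    rcases hu with h | ⟨h, h'⟩
    · exact h
    · rw [← h, sub_self, zero_mul] at huv
      nlinarith
  have hw1 : a.1 ≤ w.1 := by rcases hw with h | h <;> linarith
  have : 0 < (v.1 - a.1) * ((u.1 - a.1) * (w.2 - a.2) - (u.2 - a.2) * (w.1 - a.1)) := by
    nlinarith [mul_pos (sub_pos.2 hu1) hvw, mul_nonneg (sub_nonneg.2 hw1) huv.le]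
  exact pos_of_mul_pos_right this (sub_pos.2 hv1).le

namespace ConvexPosition

variable {p : V → Pt}

lemma injective [Nontrivial V] (h : ConvexPosition p) : Function.Injective p := by
  intro v w hvw
  by_contra hne
  exact h v w w w (Ne.symm hne) (Ne.symm hne) (Ne.symm hne) 1 0 0 (by simp) le_rfl le_rfl
    (by simp) (by simp [hvw]) (by simp [hvw])

lemma not_between (h : ConvexPosition p) {x y v : V} (hx : x ≠ v) (hy : y ≠ v) {t : ℝ}
    (ht : 0 ≤ t) (ht' : t ≤ 1) (h1 : (p v).1 - (p x).1 = t * ((p y).1 - (p x).1))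
    (h2 : (p v).2 - (p x).2 = t * ((p y).2 - (p x).2)) : False :=
  h v x y y hx hy hy (1 - t) t 0 (by linarith) ht le_rfl (by ring) (by linarith) (by linarith)

lemma orient_ne_zero (h : ConvexPosition p) {a v w : V} (hv : LexLT (p a) (p v))
    (hw : LexLT (p a) (p w)) (hva : v ≠ a) (hwa : w ≠ a) (hvw : v ≠ w) :
    orient (p a) (p v) (p w) ≠ 0 := by
  intro h0
  unfold orient at h0
  obtain ⟨t, ht, h1, h2⟩ : ∃ t : ℝ, 0 < t ∧ (p w).1 - (p a).1 = t * ((p v).1 - (p a).1) ∧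
      (p w).2 - (p a).2 = t * ((p v).2 - (p a).2) := by
    rcases hv with hv | ⟨hv, hv'⟩
    · have hpos : 0 < (p v).1 - (p a).1 := sub_pos.2 hv
      have hne := hpos.ne'
      have hw1 : (p a).1 < (p w).1 := by
        rcases hw with hw | ⟨hw, hw'⟩
        · exact hw
        · rw [← hw] at h0
          nlinarith
      refine ⟨((p w).1 - (p a).1) / ((p v).1 - (p a).1), div_pos (sub_pos.2 hw1) hpos, ?_, ?_⟩
      · field_simp
      · field_simp
        linarith
    · have hpos : 0 < (p v).2 - (p a).2 := sub_pos.2 hv'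
      have hne := hpos.ne'
      rw [← hv, sub_self, zero_mul, zero_sub, neg_eq_zero, mul_eq_zero] at h0
      have hw1 := h0.resolve_left hne
      have hw2 : (p a).2 < (p w).2 := by
        rcases hw with hw | hw
        · linarith
        · exact hw.2
      refine ⟨((p w).2 - (p a).2) / ((p v).2 - (p a).2), div_pos (sub_pos.2 hw2) hpos, ?_, ?_⟩
      · rw [hw1, ← hv]; simp
      · field_simp
  rcases le_total t 1 with h' | h'
  · exact h.not_between hwa.symm hvw ht.le h' h1 h2
  · have hne := ht.ne'
    refine h.not_between hva.symm hvw.symm (inv_nonneg.2 ht.le) (inv_le_one_of_one_le₀ h') ?_ ?_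
    · rw [h1]; field_simp
    · rw [h2]; field_simp

lemma orient_pos (h : ConvexPosition p) {a i j k : V} (hja : a ≠ j) (hij : i ≠ j) (hkj : k ≠ j)
    (h₁ : 0 < orient (p a) (p i) (p k)) (h₂ : 0 ≤ orient (p a) (p j) (p k))
    (h₃ : 0 ≤ orient (p a) (p i) (p j)) : 0 < orient (p i) (p j) (p k) := by
  by_contra! h₄
  have hne := h₁.ne'
  have hsum : orient (p a) (p j) (p k) + orient (p a) (p i) (p j) + -orient (p i) (p j) (p k)
      = orient (p a) (p i) (p k) := by unfold orient; ring
  refine h j i k a hij hkj hja (orient (p a) (p j) (p k) / orient (p a) (p i) (p k))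
    (orient (p a) (p i) (p j) / orient (p a) (p i) (p k))
    (-orient (p i) (p j) (p k) / orient (p a) (p i) (p k)) (div_nonneg h₂ h₁.le)
    (div_nonneg h₃ h₁.le) (div_nonneg (neg_nonneg.2 h₄) h₁.le) ?_ ?_ ?_
  · rw [← add_div, ← add_div, hsum, div_self hne]
  · field_simp
    unfold orient; ring
  · field_simp
    unfold orient; ring

/-- Points in convex position can be listed in counterclockwise order. -/
lemma exists_enum [Fintype V] [Nontrivial V] (h : ConvexPosition p) {n : ℕ}
    (hn : Fintype.card V = n) : ∃ e : Fin n ≃ V, ∀ i j k, i < j → j < k →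
      0 < orient (p (e i)) (p (e j)) (p (e k)) := by
  classical
  obtain ⟨a, ha⟩ := exists_lexLT_of_ne h.injective
  have htrans : ∀ u v w, u ≠ a → v ≠ a → w ≠ a → 0 < orient (p a) (p u) (p v) →
      0 < orient (p a) (p v) (p w) → 0 < orient (p a) (p u) (p w) := fun u v w hu hv hw =>
    orient_trans (ha u hu) (ha v hv) (ha w hw)
  have hself : ∀ u, orient (p a) (p u) (p u) = 0 := fun u => by unfold orient; ring
  have hswap : ∀ u v, orient (p a) (p u) (p v) = -orient (p a) (p v) (p u) := fun u v => by
    unfold orient; ring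
  let r : V → V → Prop := fun v w => v ≠ w ∧ w ≠ a ∧ (v = a ∨ 0 < orient (p a) (p v) (p w))
  have hr : IsStrictTotalOrder V r :=
    { trichotomous := by
        intro v w hvw hwv
        by_contra hne
        by_cases hv : v = a
        · exact hvw ⟨hne, fun hw => hne (hv.trans hw.symm), Or.inl hv⟩
        by_cases hw : w = a
        · exact hwv ⟨Ne.symm hne, hv, Or.inl hw⟩
        rcases lt_or_gt_of_ne (h.orient_ne_zero (ha v hv) (ha w hw) hv hw hne) with h0 | h0
        · exact hwv ⟨Ne.symm hne, hv, Or.inr (by rw [hswap]; linarith)⟩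
        · exact hvw ⟨hne, hw, Or.inr h0⟩
      irrefl := fun v hv => hv.1 rfl
      trans := by
        rintro u v w ⟨huv, hva, h₁⟩ ⟨hvw, hwa, h₂⟩
        have h₂' := h₂.resolve_left hva
        rcases eq_or_ne u a with rfl | hu
        · exact ⟨hwa.symm, hwa, Or.inl rfl⟩
        · have := htrans u v w hu hva hwa (h₁.resolve_left hu) h₂'
          refine ⟨?_, hwa, Or.inr this⟩
          rintro rfl
          exact this.ne' (hself u) }
  let _ : LinearOrder V := linearOrderOfSTO r
  have hlt : ∀ v w : V, v < w ↔ r v w := fun v w => Iff.rfl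
  let e := Fintype.orderIsoFinOfCardEq V hn
  refine ⟨e.toEquiv, fun i j k hij hjk => ?_⟩
  obtain ⟨hne₁, hja, h₁⟩ := (hlt _ _).1 (e.lt_iff_lt.2 hij)
  obtain ⟨hne₂, hka, h₂⟩ := (hlt _ _).1 (e.lt_iff_lt.2 hjk)
  have h₂' := h₂.resolve_left hja
  change 0 < orient (p (e i)) (p (e j)) (p (e k))
  by_cases hi : e i = a
  · rw [hi]; exact h₂'
  · have h₁' := h₁.resolve_left hi
    exact h.orient_pos hja.symm hne₁ hne₂.symm (htrans _ _ _ hi hja hka h₁' h₂') h₂'.le h₁'.le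

end ConvexPosition

/-- The diagonals of a convex quadrilateral cross. -/
lemma exists_mem_segment_of_orient_pos {a b c d : Pt} (h₁ : 0 < orient a b c)
    (h₂ : 0 < orient a b d) (h₃ : 0 < orient a c d) (h₄ : 0 < orient b c d) :
    ∃ z, z ∈ segment ℝ a c ∧ z ∈ segment ℝ b d := by
  have hS : 0 < orient b c d + orient a b d := by linarith
  have hS' : orient a c d + orient a b c = orient b c d + orient a b d := by
    unfold orient; ring
  have hne := hS.ne'
  refine ⟨(orient b c d / (orient b c d + orient a b d)) • a +
    (orient a b d / (orient b c d + orient a b d)) • c, ⟨_, _, (div_pos h₄ hS).le,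
    (div_pos h₂ hS).le, by rw [← add_div, div_self hne], rfl⟩,
    ⟨orient a c d / (orient b c d + orient a b d), orient a b c / (orient b c d + orient a b d),
    (div_pos h₃ hS).le, (div_pos h₁ hS).le, by rw [← add_div, hS', div_self hne], ?_⟩⟩
  ext
  · simp only [Prod.fst_add, Prod.smul_fst, smul_eq_mul]
    field_simp
    unfold orient; ring
  · simp only [Prod.snd_add, Prod.smul_snd, smul_eq_mul]
    field_simp
    unfold orient; ring

/-- An outer-planar graph with at least two vertices is contained in a triangulated polygon. -/
lemma exists_triangPoly_of_convexPosition [Fintype V] (G : SimpleGraph V)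
    (hV : 2 ≤ Fintype.card V) {Γ : StraightDrawing G} (hΓ : Γ.IsPlanar)
    (h : ConvexPosition Γ.pos) :
    ∃ a b F, TriangPoly a b univ F (Fintype.card V - 1) ∧ G.edgeSet ⊆ F := by
  have : Nontrivial V := Fintype.one_lt_card_iff_nontrivial.1 hV
  obtain ⟨n, hn⟩ : ∃ n, Fintype.card V = n := ⟨_, rfl⟩
  obtain ⟨e, he⟩ := h.exists_enum hn
  rw [hn] at hV ⊢
  let f : ℕ → V := fun k => if hk : k < n then e ⟨k, hk⟩ else e ⟨0, by omega⟩
  have hfe : ∀ k (hk : k < n), f k = e ⟨k, hk⟩ := fun k hk => dif_pos hk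
  have hf : InjOn f (Iio n) := by
    intro x hx y hy hxy
    rw [hfe x hx, hfe y hy] at hxy
    exact congrArg Fin.val (e.injective hxy)
  have hor : ∀ i j k, i < j → j < k → k < n →
      0 < orient (Γ.pos (f i)) (Γ.pos (f j)) (Γ.pos (f k)) := by
    intro i j k hij hjk hk
    rw [hfe i (by omega), hfe j (by omega), hfe k hk]
    exact he _ _ _ (Fin.mk_lt_mk.2 hij) (Fin.mk_lt_mk.2 hjk)
  have hG : ∀ i j k l, i < j → j < k → k < l → l < n → G.Adj (f i) (f k) →
      ¬ G.Adj (f j) (f l) := by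
    intro i j k l hij hjk hkl hl hik hjl
    have hne : ∀ x y, x < n → y < n → x ≠ y → f x ≠ f y := fun x y hx hy hxy h' =>
      hxy (hf hx hy h')
    have h1 := hne i j (by omega) (by omega) (by omega)
    have h2 := hne i l (by omega) (by omega) (by omega)
    have h3 := hne k j (by omega) (by omega) (by omega)
    have h4 := hne k l (by omega) (by omega) (by omega)
    obtain ⟨z, hz₁, hz₂⟩ := exists_mem_segment_of_orient_pos (hor i j k hij hjk (by omega))
      (hor i j l hij (by omega) hl) (hor i k l (by omega) hkl hl) (hor j k l hjk hkl hl)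
    obtain ⟨w, hw₁, hw₂, -⟩ := hΓ.2 s(f i, f k) hik s(f j, f l) hjl
      (by simp [h1, h2, h3]) z ⟨hz₁, hz₂⟩
    rw [Sym2.mem_iff] at hw₁ hw₂
    rcases hw₁ with rfl | rfl <;> rcases hw₂ with hw | hw <;> contradiction
  obtain ⟨F, hF, hGF⟩ := exists_triangPoly G hf hG (n - 1 - 0) 0 (n - 1) rfl (by omega) (by omega)
  have hsurj : ∀ v, ∃ x < n, f x = v := fun v =>
    ⟨e.symm v, (e.symm v).2, by rw [hfe _ (e.symm v).2]; simp⟩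
  have huniv : f '' Icc 0 (n - 1) = univ := by
    refine eq_univ_of_forall fun v => ?_
    obtain ⟨x, hx, rfl⟩ := hsurj v
    exact ⟨x, ⟨by omega, by omega⟩, rfl⟩
  rw [huniv] at hF
  refine ⟨_, _, F, hF, fun ed hed => ?_⟩
  induction ed using Sym2.ind with
  | _ u v =>
    obtain ⟨x, hx, rfl⟩ := hsurj u
    obtain ⟨y, hy, rfl⟩ := hsurj v
    have hadj : G.Adj (f x) (f y) := hed
    rcases lt_trichotomy x y with hxy | rfl | hxy
    · exact hGF x y (by omega) hxy (by omega) hadj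
    · exact absurd hadj (G.loopless.irrefl _)
    · rw [Sym2.eq_swap]
      exact hGF y x (by omega) hxy (by omega) hadj.symm

/-- A spanning subgraph of a triangulated polygon with few vertices has a planar drawing of
small height. -/
lemma exists_drawing_of_triangPoly (G : SimpleGraph V) {a b : V} {F : Set (Sym2 V)} {m k : ℕ}
    (h : TriangPoly a b univ F m) (hG : G.edgeSet ⊆ F) (hm : m ≤ 2 ^ k) :
    ∃ Γ : StraightDrawing G, Γ.IsPlanar ∧
      ∀ v, ∃ y : ℤ, 1 ≤ y ∧ y ≤ 2 * k + 1 ∧ (Γ.pos v).2 = y := by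
  obtain ⟨q, hq, hinty, hqa, hqb, hrow⟩ : Drawable (0, 1) (1, 1)
      (fun _ y => 1 ≤ y ∧ y ≤ 2 * k + 1) a b univ F :=
    (triDrawable_of_le_two_pow k a b univ F m h hm).map 1 0 0 1 1 one_ne_zero one_ne_zero
      (by simp [rowMap]) (by simp [rowMap]) (by
        rintro x y ⟨-, h1, h2, -⟩
        push_cast [rowMap] at h2 ⊢
        constructor <;> linarith)
  refine ⟨⟨q, injOn_univ.1 hq.1⟩, ⟨?_, ?_⟩, fun v => ?_⟩
  · exact fun v e he hv hmem => hv (h.mem_of_pos_mem hq (mem_univ v) (hG he) hmem)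
  · exact fun e he f hf hef z hz => hq.2 e (hG he) f (hG hf) hef z hz.1 hz.2
  · obtain ⟨y, hy⟩ := hinty v (mem_univ v)
    have hbd : 1 ≤ (q v).2 ∧ (q v).2 ≤ 2 * k + 1 := by
      by_cases hva : v = a
      · rw [hva, hqa]; constructor <;> simp
      by_cases hvb : v = b
      · rw [hvb, hqb]; constructor <;> simp
      exact hrow v (mem_univ v) hva hvb
    rw [hy] at hbd
    exact ⟨y, by exact_mod_cast hbd.1, by exact_mod_cast hbd.2, hy⟩

end OuterPlanar

/-- There is a constant `C > 0` such that every simple graph on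
`n ≥ 2` vertices admitting a planar straight-line drawing with all vertex points in
convex position (i.e. every outer-planar graph) admits a planar straight-line drawing
with all vertex `y`-coordinates integers in `{1, …, ⌈C·log₂ n⌉}`. -/
theorem stmt16 :
    ∃ C : ℝ, 0 < C ∧
      ∀ (V : Type) [Fintype V] (G : SimpleGraph V), 2 ≤ Fintype.card V →
        (∃ Γ : StraightDrawing G, Γ.IsPlanar ∧
          ∀ v : V, Γ.pos v ∈ Set.extremePoints ℝ (convexHull ℝ (Set.range Γ.pos))) →
        ∃ Γ' : StraightDrawing G, Γ'.IsPlanar ∧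
          ∀ v : V, ∃ k : ℤ, 1 ≤ k ∧ k ≤ ⌈C * Real.logb 2 (Fintype.card V)⌉ ∧
            (Γ'.pos v).2 = (k : ℝ) := by
  refine ⟨5, by norm_num, fun V _ G hV ⟨Γ, hΓ, hext⟩ => ?_⟩
  obtain ⟨a, b, F, hF, hGF⟩ := OuterPlanar.exists_triangPoly_of_convexPosition G hV hΓ
    (OuterPlanar.convexPosition_of_extremePoints Γ.pos_inj hext)
  obtain ⟨Γ', hΓ', hrow⟩ := OuterPlanar.exists_drawing_of_triangPoly G hF hGF
    ((Nat.sub_le _ _).trans (Nat.le_pow_clog one_lt_two _))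
  refine ⟨Γ', hΓ', fun v => ?_⟩
  obtain ⟨y, h1, h2, hy⟩ := hrow v
  refine ⟨y, h1, Int.le_ceil_iff.2 ?_, hy⟩
  have hn : (2 : ℝ) ≤ Fintype.card V := by exact_mod_cast hV
  have hlog : 1 ≤ Real.logb 2 (Fintype.card V) := by
    rw [Real.le_logb_iff_rpow_le one_lt_two (by linarith), Real.rpow_one]
    exact hn
  have hclog : (Nat.clog 2 (Fintype.card V) : ℝ) < Real.logb 2 (Fintype.card V) + 1 := by
    have := Real.ceil_logb_natCast (b := 2) (r := (Fintype.card V : ℝ)) (by positivity)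
    rw [Int.clog_natCast] at this
    have h3 := Int.ceil_lt_add_one (Real.logb 2 (Fintype.card V))
    have h4 : ((⌈Real.logb 2 (Fintype.card V)⌉ : ℤ) : ℝ) = Nat.clog 2 (Fintype.card V) := by
      exact_mod_cast congrArg (Int.cast : ℤ → ℝ) this
    linarith
  have h2' : (y : ℝ) ≤ 2 * (Nat.clog 2 (Fintype.card V) : ℝ) + 1 := by exact_mod_cast h2
  linarith
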